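/- Let C = R_max/(1−φ) and let W be a function from beliefs to ℝ with 0 ≤ W(b) ≤ C for all beliefs b and |W(b) − W(b')| ≤ C · Σ_s |b(s) − b'(s)| for all beliefs b, b'. Then for every belief b, action u ∈ U, action v ∈ V and observation o ∈ O with Pr_{Pr*}(v,o|b,u) > 0 and Pr_{Pr}(v,o|b,u) > 0: |W(B_{Pr*}(b,u,v,o)) · Pr_{Pr*}(v,o|b,u) − W(B_{Pr}(b,u,v,o)) · Pr_{Pr}(v,o|b,u)| ≤ 3 ε_p R_max/(1−φ). -/

import Mathlib

open Finset

noncomputable section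

variable {S U V O : Type*}

/-- `b : S → ℝ` is a belief (probability distribution over states). -/
def IsBelief [Fintype S] (b : S → ℝ) : Prop :=
  (∀ s, 0 ≤ b s) ∧ ∑ s, b s = 1

/-- `P : S → V → ℝ` is a (mixed) strategy of the other agent. -/
def IsStrategy [Fintype V] (P : S → V → ℝ) : Prop :=
  (∀ s v, 0 ≤ P s v) ∧ ∀ s, ∑ v, P s v = 1

/-- Expected immediate payoff `R_P(b,u) = Σ_{s,v} b(s) P(s,v) R(s,u,v)`. -/
def expR [Fintype S] [Fintype V] (R : S → U → V → ℝ) (P : S → V → ℝ)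
    (b : S → ℝ) (u : U) : ℝ :=
  ∑ s, ∑ v, b s * P s v * R s u v

/-- Belief-state observation model
`Pr_P(v,o|b,u) = Σ_{s'} Z(s',u,o) Σ_s T(s,u,v,s') P(s,v) b(s)`. -/
def obsPr [Fintype S] (T : S → U → V → S → ℝ) (Z : S → U → O → ℝ)
    (P : S → V → ℝ) (b : S → ℝ) (u : U) (v : V) (o : O) : ℝ :=
  ∑ s', Z s' u o * ∑ s, T s u v s' * P s v * b s

/-- Unnormalized belief update
`F_P(b,u,v,o)(s') = Z(s',u,o) Σ_s T(s,u,v,s') P(s,v) b(s)`. -/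
def unnormUpd [Fintype S] (T : S → U → V → S → ℝ) (Z : S → U → O → ℝ)
    (P : S → V → ℝ) (b : S → ℝ) (u : U) (v : V) (o : O) (s' : S) : ℝ :=
  Z s' u o * ∑ s, T s u v s' * P s v * b s

/-- Normalized belief update `B_P(b,u,v,o)`. -/
def beliefUpd [Fintype S] (T : S → U → V → S → ℝ) (Z : S → U → O → ℝ)
    (P : S → V → ℝ) (b : S → ℝ) (u : U) (v : V) (o : O) (s' : S) : ℝ :=
  unnormUpd T Z P b u v o s' / obsPr T Z P b u v o

/-- Value function of I-POMDP Lite: `V^P_0(b) = 0` and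
`V^P_{n+1}(b) = max_u [ R_P(b,u) + φ Σ_{v,o} Pr_P(v,o|b,u) V^P_n(B_P(b,u,v,o)) ]`
(summands with `Pr_P(v,o|b,u) = 0` vanish since they are multiplied by `0`). -/
def valFun [Fintype S] [Fintype U] [Fintype V] [Fintype O] [Nonempty U]
    (T : S → U → V → S → ℝ) (Z : S → U → O → ℝ) (R : S → U → V → ℝ)
    (P : S → V → ℝ) (φ : ℝ) : ℕ → (S → ℝ) → ℝ
  | 0, _ => 0
  | n + 1, b => ⨆ u : U, (expR R P b u +
      φ * ∑ v, ∑ o, obsPr T Z P b u v o * valFun T Z R P φ n (beliefUpd T Z P b u v o))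

/-- Q-function of I-POMDP Lite: `qFun … n` is `Q^P_{n+1}`, i.e.
`Q^P_{n+1}(b,u) = R_P(b,u) + φ Σ_{v,o} Pr_P(v,o|b,u) V^P_n(B_P(b,u,v,o))`,
so that `V^P_{n+1}(b) = max_u (qFun … n b u)`. -/
def qFun [Fintype S] [Fintype U] [Fintype V] [Fintype O] [Nonempty U]
    (T : S → U → V → S → ℝ) (Z : S → U → O → ℝ) (R : S → U → V → ℝ)
    (P : S → V → ℝ) (φ : ℝ) (n : ℕ) (b : S → ℝ) (u : U) : ℝ :=
  expR R P b u +
    φ * ∑ v, ∑ o, obsPr T Z P b u v o * valFun T Z R P φ n (beliefUpd T Z P b u v o)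

/-- Prediction error `ε_p = max_{s,v} |Pr*(s,v) − Pr(s,v)|`. -/
def predErr [Fintype S] [Fintype V] [Nonempty S] [Nonempty V]
    (Pstar Ppred : S → V → ℝ) : ℝ :=
  ⨆ s : S, ⨆ v : V, |Pstar s v - Ppred s v|

/-- Expected total reward of executing the (greedy) policy `π` under the true
strategy `Pstar`: `J_0(b) = 0` and
`J_{k+1}(b) = R_{P*}(b,π_{k+1}(b)) + φ Σ_{v,o} Pr_{P*}(v,o|b,π_{k+1}(b)) J_k(B_{P*}(b,π_{k+1}(b),v,o))`. -/
def execJ [Fintype S] [Fintype V] [Fintype O]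
    (T : S → U → V → S → ℝ) (Z : S → U → O → ℝ) (R : S → U → V → ℝ)
    (Pstar : S → V → ℝ) (φ : ℝ) (π : ℕ → (S → ℝ) → U) : ℕ → (S → ℝ) → ℝ
  | 0, _ => 0
  | k + 1, b =>
      expR R Pstar b (π (k + 1) b) +
        φ * ∑ v, ∑ o, obsPr T Z Pstar b (π (k + 1) b) v o *
          execJ T Z R Pstar φ π k (beliefUpd T Z Pstar b (π (k + 1) b) v o)

theorem abs_sub_le_predErr [Fintype S] [Fintype V] [Nonempty S] [Nonempty V]
    (P Q : S → V → ℝ) (s : S) (v : V) : |P s v - Q s v| ≤ predErr P Q :=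
  (le_ciSup (f := fun v => |P s v - Q s v|) (Set.finite_range _).bddAbove v).trans
    (le_ciSup (f := fun s => ⨆ v, |P s v - Q s v|) (Set.finite_range _).bddAbove s)

theorem unnormUpd_nonneg [Fintype S] [Fintype V] {T : S → U → V → S → ℝ} {Z : S → U → O → ℝ}
    {P : S → V → ℝ} {b : S → ℝ} (hT0 : ∀ s u v s', 0 ≤ T s u v s')
    (hZ0 : ∀ s' u o, 0 ≤ Z s' u o) (hP : IsStrategy P) (hb : IsBelief b)
    (u : U) (v : V) (o : O) (s' : S) : 0 ≤ unnormUpd T Z P b u v o s' :=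
  mul_nonneg (hZ0 _ _ _) (sum_nonneg fun _ _ =>
    mul_nonneg (mul_nonneg (hT0 _ _ _ _) (hP.1 _ _)) (hb.1 _))

theorem sum_abs_unnormUpd_sub_le [Fintype S] [Fintype V] [Fintype O] [Nonempty S] [Nonempty V]
    {T : S → U → V → S → ℝ} {Z : S → U → O → ℝ} (P Q : S → V → ℝ) {b : S → ℝ}
    (hT0 : ∀ s u v s', 0 ≤ T s u v s') (hT1 : ∀ s u v, ∑ s', T s u v s' = 1)
    (hZ0 : ∀ s' u o, 0 ≤ Z s' u o) (hZ1 : ∀ s' u, ∑ o, Z s' u o = 1)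
    (hb : IsBelief b) (u : U) (v : V) (o : O) :
    ∑ s', |unnormUpd T Z P b u v o s' - unnormUpd T Z Q b u v o s'| ≤ predErr P Q := by
  have hZ_le (s') : Z s' u o ≤ 1 := by
    rw [← hZ1 s' u]
    exact single_le_sum (f := fun o => Z s' u o) (fun o _ => hZ0 s' u o) (mem_univ o)
  calc
    _ ≤ ∑ s', ∑ s, T s u v s' * predErr P Q * b s := by
      refine sum_le_sum fun s' _ => ?_
      rw [unnormUpd, unnormUpd, ← mul_sub, abs_mul, abs_of_nonneg (hZ0 _ _ _),
        ← sum_sub_distrib]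
      refine (mul_le_of_le_one_left (abs_nonneg _) (hZ_le s')).trans
        ((abs_sum_le_sum_abs _ _).trans (sum_le_sum fun s _ => ?_))
      rw [← sub_mul, ← mul_sub, abs_mul, abs_mul, abs_of_nonneg (hb.1 s),
        abs_of_nonneg (hT0 _ _ _ _)]
      exact mul_le_mul_of_nonneg_right
        (mul_le_mul_of_nonneg_left (abs_sub_le_predErr P Q s v) (hT0 _ _ _ _)) (hb.1 s)
    _ = predErr P Q := by
      rw [sum_comm]
      simp_rw [← sum_mul, hT1, one_mul]
      rw [← mul_sum, hb.2, mul_one]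

/-- Rescaling a bounded, ℓ¹-Lipschitz function of normalized vectors by the total mass is
ℓ¹-Lipschitz on unnormalized vectors, with three times the constant. -/
theorem abs_apply_normalize_mul_sum_sub_le [Fintype S] {W : (S → ℝ) → ℝ} {C : ℝ}
    (hC : 0 ≤ C) (hWbdd : ∀ b : S → ℝ, IsBelief b → 0 ≤ W b ∧ W b ≤ C)
    (hWlip : ∀ b b' : S → ℝ, IsBelief b → IsBelief b' → |W b - W b'| ≤ C * ∑ s, |b s - b' s|)
    {f g : S → ℝ} (hf : ∀ s, 0 ≤ f s) (hg : ∀ s, 0 ≤ g s)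
    (hfpos : 0 < ∑ s, f s) (hgpos : 0 < ∑ s, g s) :
    |W (fun s => f s / ∑ t, f t) * ∑ s, f s - W (fun s => g s / ∑ t, g t) * ∑ s, g s| ≤
      3 * C * ∑ s, |f s - g s| := by
  have hmass : |∑ s, f s - ∑ s, g s| ≤ ∑ s, |f s - g s| := by
    rw [← sum_sub_distrib]
    exact abs_sum_le_sum_abs _ _
  have hbf : IsBelief fun s => f s / ∑ t, f t :=
    ⟨fun s => div_nonneg (hf s) hfpos.le, by rw [← sum_div, div_self hfpos.ne']⟩
  have hbg : IsBelief fun s => g s / ∑ t, g t :=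
    ⟨fun s => div_nonneg (hg s) hgpos.le, by rw [← sum_div, div_self hgpos.ne']⟩
  obtain ⟨hW0, hWC⟩ := hWbdd _ hbg
  have hL := hWlip _ _ hbf hbg
  generalize hp : ∑ s, f s = p at *
  generalize hq : ∑ s, g s = q at *
  have hnorm : (∑ s, |f s / p - g s / q|) * p ≤ 2 * ∑ s, |f s - g s| := by
    calc
      _ ≤ ∑ s, (|f s - g s| + g s / q * |p - q|) := by
        rw [sum_mul]
        refine sum_le_sum fun s _ => ?_
        have h : (f s / p - g s / q) * p = (f s - g s) - g s / q * (p - q) := by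
          field_simp
          ring
        rw [← abs_of_pos hfpos, ← abs_mul, abs_of_pos hfpos, h]
        refine (abs_sub _ _).trans_eq ?_
        rw [abs_mul, abs_of_nonneg (div_nonneg (hg s) hgpos.le)]
      _ = (∑ s, |f s - g s|) + |p - q| := by
        rw [sum_add_distrib, ← sum_mul, ← sum_div, hq, div_self hgpos.ne', one_mul]
      _ ≤ _ := by linarith
  generalize W (fun s => f s / p) = w at *
  generalize W (fun s => g s / q) = w' at *
  calc
    |w * p - w' * q| = |(w - w') * p + w' * (p - q)| := by congr 1; ring
    _ ≤ |w - w'| * p + w' * |p - q| := by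
      refine (abs_add_le _ _).trans_eq ?_
      rw [abs_mul, abs_mul, abs_of_pos hfpos, abs_of_nonneg hW0]
    _ ≤ C * (∑ s, |f s / p - g s / q|) * p + C * ∑ s, |f s - g s| := by gcongr
    _ ≤ 3 * C * ∑ s, |f s - g s| := by
      have := mul_le_mul_of_nonneg_left hnorm hC
      linarith

/-- **Proposition 2:** for any `[0, R_max/(1−φ)]`-bounded, ℓ¹-Lipschitz function
`W` on beliefs,
`|W(B_{Pr*}(b,u,v,o)) Pr_{Pr*}(v,o|b,u) − W(B_{Pr}(b,u,v,o)) Pr_{Pr}(v,o|b,u)| ≤ 3 ε_p R_max/(1−φ)`. -/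
theorem ipomdp_lite_weighted_value_update_diff
    [Fintype S] [Fintype U] [Fintype V] [Fintype O]
    [Nonempty S] [Nonempty U] [Nonempty V] [Nonempty O]
    (T : S → U → V → S → ℝ) (Z : S → U → O → ℝ)
    (Pstar Ppred : S → V → ℝ) (Rmax φ : ℝ)
    (hRmax : 0 ≤ Rmax) (hφ0 : 0 < φ) (hφ1 : φ < 1)
    (hT0 : ∀ s u v s', 0 ≤ T s u v s') (hT1 : ∀ s u v, ∑ s', T s u v s' = 1)
    (hZ0 : ∀ s' u o, 0 ≤ Z s' u o) (hZ1 : ∀ s' u, ∑ o, Z s' u o = 1)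
    (hPstar : IsStrategy Pstar) (hPpred : IsStrategy Ppred)
    (W : (S → ℝ) → ℝ)
    (hWbdd : ∀ b : S → ℝ, IsBelief b → 0 ≤ W b ∧ W b ≤ Rmax / (1 - φ))
    (hWlip : ∀ b b' : S → ℝ, IsBelief b → IsBelief b' →
      |W b - W b'| ≤ (Rmax / (1 - φ)) * ∑ s, |b s - b' s|) :
    ∀ b : S → ℝ, IsBelief b → ∀ (u : U) (v : V) (o : O),
      0 < obsPr T Z Pstar b u v o → 0 < obsPr T Z Ppred b u v o →
      |W (beliefUpd T Z Pstar b u v o) * obsPr T Z Pstar b u v o -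
        W (beliefUpd T Z Ppred b u v o) * obsPr T Z Ppred b u v o| ≤
          3 * predErr Pstar Ppred * Rmax / (1 - φ) := by
  intro b hb u v o hp hq
  have hC : 0 ≤ Rmax / (1 - φ) := div_nonneg hRmax (sub_nonneg.2 hφ1.le)
  calc
    _ ≤ 3 * (Rmax / (1 - φ)) *
        ∑ s, |unnormUpd T Z Pstar b u v o s - unnormUpd T Z Ppred b u v o s| :=
      abs_apply_normalize_mul_sum_sub_le hC hWbdd hWlip
        (unnormUpd_nonneg hT0 hZ0 hPstar hb u v o) (unnormUpd_nonneg hT0 hZ0 hPpred hb u v o) hp hq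
    _ ≤ 3 * (Rmax / (1 - φ)) * predErr Pstar Ppred := by
      gcongr
      exact sum_abs_unnormUpd_sub_le Pstar Ppred hT0 hT1 hZ0 hZ1 hb u v o
    _ = 3 * predErr Pstar Ppred * Rmax / (1 - φ) := by ring
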